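/- For every lattice path π ∈ L_{n,n} one has sw(π) = ζ_C(π); in particular the sweep map sw : L_{n,n} → B_{2n} is a bijection. -/

import Mathlib

inductive Step
  | N : Step
  | E : Step
  deriving DecidableEq

/-- The number of East steps strictly preceding the `k`-th North step. -/
def ebn : List Step → ℕ → ℕ
  | _, 0 => 0
  | [], _ + 1 => 0
  | Step.E :: rest, k + 1 => ebn rest (k + 1) + 1
  | Step.N :: rest, k + 1 => ebn rest k

/-- A lattice path with `a` East steps and `b` North steps. -/
def IsLatticePath (a b : ℕ) (π : List Step) : Prop :=
  π.count Step.E = a ∧ π.count Step.N = b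

/-- A ballot path of length `m`: every prefix has at least as many `N`s as `E`s. -/
def IsBallotPath (m : ℕ) (β : List Step) : Prop :=
  β.length = m ∧ ∀ k : ℕ, (β.take k).count Step.E ≤ (β.take k).count Step.N

/-- `i` is a rise: the `i`-th North step is immediately followed by a North step. -/
def IsRise (π : List Step) (i : ℕ) : Prop :=
  ∃ p : ℕ, π[p]? = some Step.N ∧ π[p + 1]? = some Step.N ∧ (π.take p).count Step.N + 1 = i

/-- `(i,j)` is a valley: the `i`-th East step is immediately followed by the `j`-th North
step; in addition if the path ends with an East step and consists of `i` East steps and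
`j - 1` North steps, then `(i, j)` counts as a valley. -/
def IsValley (β : List Step) (i j : ℕ) : Prop :=
  (∃ p : ℕ, β[p]? = some Step.E ∧ β[p + 1]? = some Step.N ∧
      (β.take p).count Step.E + 1 = i ∧ (β.take (p + 1)).count Step.N + 1 = j) ∨
  (β.getLast? = some Step.E ∧ i = β.count Step.E ∧ j = β.count Step.N + 1)

/-- Read `a` from left to right, writing `N` for each entry `j` and `E` for each entry `j+1`. -/
def sPlusL (j : ℤ) (a : List ℤ) : List Step :=
  a.filterMap fun x => if x = j then some Step.N else if x = j + 1 then some Step.E else none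

/-- Read `a` from right to left, writing `N` for each entry `j` and `E` for each entry `j+1`. -/
def sPlusR (j : ℤ) (a : List ℤ) : List Step := sPlusL j a.reverse

/-- Read `a` from left to right, writing `N` for each entry `-j` and `E` for each entry `-j-1`. -/
def sMinusL (j : ℤ) (a : List ℤ) : List Step :=
  a.filterMap fun x => if x = -j then some Step.N else if x = -j - 1 then some Step.E else none

/-- Read `a` from right to left, writing `N` for each entry `-j` and `E` for each entry `-j-1`. -/
def sMinusR (j : ℤ) (a : List ℤ) : List Step := sMinusL j a.reverse

/-- The type `Cₙ` area vector of a lattice path, `μ k = (n+1-k) - λ_{n+1-k}` (1-based). -/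
def areaC (n : ℕ) (π : List Step) (k : ℕ) : ℤ :=
  ((n : ℤ) + 1 - k) - ebn π (n + 1 - k)

def areaCList (n : ℕ) (π : List Step) : List ℤ :=
  (List.range n).map fun k => areaC n π (k + 1)

/-- The type `Cₙ` zeta map. -/
def zetaC (n : ℕ) (π : List Step) : List Step :=
  ((List.range (n + 1)).reverse.map (fun j =>
    sMinusR (j : ℤ) (areaCList n π) ++ sPlusL (j : ℤ) (areaCList n π))).flatten

/-- The labels `ℓ_i` of the steps of a path, starting from the given value. -/
def sweepLabels (n : ℕ) : List Step → ℤ → List ℤ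
  | [], _ => []
  | s :: rest, l =>
      l :: sweepLabels n rest (if s = Step.N then l + (2 * (n : ℤ) + 1) else l - 2 * (n : ℤ))

/-- The collection `X` of labelled steps. -/
def sweepX (n : ℕ) (π : List Step) : List (Step × ℤ) :=
  (List.range π.length).filterMap fun im =>
    match (sweepLabels n π 0)[im]? with
    | some l =>
      if l < 0 then (π[im]?).map (fun s => (s, l))
      else if 0 < l then (π[im - 1]?).map (fun s => (s, -l))
      else π.getLast?.map (fun s => (s, -(n : ℤ)))
    | none => none

/-- The sweep map: arrange the steps of `X` in increasing order of their labels. -/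
def sweep (n : ℕ) (π : List Step) : List Step :=
  (List.insertionSort (fun p q : Step × ℤ => p.2 ≤ q.2) (sweepX n π)).map Prod.fst

/-- The levels reached by the successive North steps of a path starting at level `h`, where a North
step raises the level by one and an East step lowers it by one. -/
def northLevels : List Step → ℤ → List ℤ
  | [], _ => []
  | Step.N :: r, h => (h + 1) :: northLevels r (h + 1)
  | Step.E :: r, h => northLevels r (h - 1)

/-- The concatenation `f (m - 1) ++ ⋯ ++ f 1 ++ f 0`. -/
def descConcat {α : Type*} (f : ℕ → List α) (m : ℕ) : List α :=
  ((List.range m).reverse.map f).flatten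

theorem descConcat_zero {α : Type*} (f : ℕ → List α) : descConcat f 0 = [] := rfl

theorem descConcat_succ {α : Type*} (f : ℕ → List α) (m : ℕ) :
    descConcat f (m + 1) = f m ++ descConcat f m := by
  simp [descConcat, List.range_succ]

theorem descConcat_succ' {α : Type*} (f : ℕ → List α) (m : ℕ) :
    descConcat f (m + 1) = descConcat (fun j => f (j + 1)) m ++ f 0 := by
  simp [descConcat, List.range_succ_eq_map, Function.comp_def]

theorem northLevels_eq_map (π : List Step) (h : ℤ) :
    northLevels π h =
      (List.range (π.count Step.N)).map fun i => h + (i + 1 : ℕ) - ebn π (i + 1) := by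
  induction π generalizing h with
  | nil => rfl
  | cons s r ih =>
    cases s with
    | N =>
      simp only [northLevels, ih, List.count_cons_self, List.range_succ_eq_map, List.map_cons,
        List.map_map, ebn]
      congr 1
      · cases r <;> simp
      · refine List.map_congr_left fun i _ => ?_
        simp
        ring
    | E =>
      simp only [northLevels, ih, ebn]
      rw [List.count_cons_of_ne (by decide)]
      refine List.map_congr_left fun i _ => ?_
      push_cast
      ring

theorem areaCList_reverse {n : ℕ} {π : List Step} (hN : π.count Step.N = n) :
    (areaCList n π).reverse = northLevels π 0 := by
  rw [northLevels_eq_map, hN]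
  refine List.ext_getElem (by simp [areaCList]) fun i h₁ h₂ => ?_
  have hi : i < n := by simpa using h₂
  have e : n + 1 - (n - 1 - i + 1) = i + 1 := by omega
  simp only [areaCList, List.getElem_reverse, List.getElem_map, List.getElem_range,
    List.length_map, List.length_range, areaC, e]
  push_cast [show i ≤ n - 1 by omega, show 1 ≤ n by omega]
  ring

theorem zetaC_eq_descConcat {n : ℕ} {π : List Step} (hN : π.count Step.N = n) :
    zetaC n π = descConcat (fun j => sMinusL j (northLevels π 0) ++
      (sPlusL j (northLevels π 0)).reverse) (n + 1) := by
  rw [← areaCList_reverse hN]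
  simp [zetaC, descConcat, sMinusR, sPlusL, ← List.filterMap_reverse, ← List.map_eq_flatMap,
    Function.comp_def]

theorem sPlusL_cons (j x : ℤ) (a : List ℤ) :
    sPlusL j (x :: a) =
      (if x = j then [Step.N] else if x = j + 1 then [Step.E] else []) ++ sPlusL j a := by
  simp only [sPlusL, List.filterMap_cons]
  split_ifs <;> rfl

theorem sMinusL_cons (j x : ℤ) (a : List ℤ) :
    sMinusL j (x :: a) =
      (if x = -j then [Step.N] else if x = -j - 1 then [Step.E] else []) ++ sMinusL j a := by
  simp only [sMinusL, List.filterMap_cons]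
  split_ifs <;> rfl

section Counting

variable (j : ℤ) (a : List ℤ)

theorem count_N_sPlusL : (sPlusL j a).count Step.N = a.count j := by
  induction a with
  | nil => rfl
  | cons x a ih => grind [sPlusL_cons]

theorem count_E_sPlusL : (sPlusL j a).count Step.E = a.count (j + 1) := by
  induction a with
  | nil => rfl
  | cons x a ih => grind [sPlusL_cons]

theorem count_N_sMinusL : (sMinusL j a).count Step.N = a.count (-j) := by
  induction a with
  | nil => rfl
  | cons x a ih => grind [sMinusL_cons]

theorem count_E_sMinusL : (sMinusL j a).count Step.E = a.count (-j - 1) := by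
  induction a with
  | nil => rfl
  | cons x a ih => grind [sMinusL_cons]

end Counting

/-- Exchange North and East steps. -/
def Step.swap : Step → Step
  | Step.N => Step.E
  | Step.E => Step.N

theorem sPlusL_eq_map_swap (j : ℤ) (a : List ℤ) :
    sPlusL (-j - 1) a = (sMinusL j a).map Step.swap := by
  induction a with
  | nil => rfl
  | cons x a ih =>
    rw [sPlusL_cons, sMinusL_cons, List.map_append, ih]
    split_ifs <;> first | omega | rfl

theorem mem_northLevels_bounds {π : List Step} {h x : ℤ} (hx : x ∈ northLevels π h) :
    h - π.count Step.E < x ∧ x ≤ h + π.count Step.N := by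
  induction π generalizing h with
  | nil => simp [northLevels] at hx
  | cons s r ih => cases s <;> grind [northLevels]

theorem head?_sPlusL_northLevels {π : List Step} {h j : ℤ} (hj : h < j) :
    ∀ s ∈ (sPlusL j (northLevels π h)).head?, s = Step.N := by
  induction π generalizing h with
  | nil => simp [northLevels, sPlusL]
  | cons s r ih =>
    cases s <;> grind [northLevels, sPlusL_cons]

theorem getLast?_sMinusL_northLevels {π : List Step} {h j : ℤ}
    (hend : h + π.count Step.N = π.count Step.E) (hj : 0 ≤ j) :
    (∀ s ∈ (sMinusL j (northLevels π h)).getLast?, s = Step.N) ∧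
      (h < -j → sMinusL j (northLevels π h) ≠ []) := by
  induction π generalizing h with
  | nil => simp [northLevels, sMinusL] at *; omega
  | cons s r ih =>
    cases s with
    | N =>
      have ih := @ih (h + 1) (by grind)
      simp only [northLevels]
      rw [sMinusL_cons]
      by_cases h1 : h + 1 = -j
      · rw [if_pos h1]; grind
      by_cases h2 : h + 1 = -j - 1
      · rw [if_neg h1, if_pos h2]; grind
      rw [if_neg h1, if_neg h2]
      exact ⟨ih.1, fun _ => ih.2 (by omega)⟩
    | E =>
      have ih := @ih (h - 1) (by grind)
      simp only [northLevels]
      exact ⟨ih.1, fun _ => ih.2 (by omega)⟩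

theorem eq_of_sPlusL_northLevels_eq {π π' : List Step} {h : ℤ} (hlen : π.length = π'.length)
    (hw : ∀ c, sPlusL c (northLevels π h) = sPlusL c (northLevels π' h)) : π = π' := by
  induction π generalizing π' h with
  | nil => exact (List.length_eq_zero_iff.1 hlen.symm).symm
  | cons s r ih =>
    cases π' with
    | nil => simp at hlen
    | cons s' r' =>
      have key : ∀ {q q' : List Step}, sPlusL h (northLevels (Step.N :: q) h) ≠
          sPlusL h (northLevels (Step.E :: q') h) := by
        intro q q' he
        have := @head?_sPlusL_northLevels q' (h - 1) h (by omega)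
        simp only [northLevels] at he
        rw [← he] at this
        simp [sPlusL] at this
      have hlen' : r.length = r'.length := by simpa using hlen
      cases s <;> cases s'
      · rw [ih hlen' (h := h + 1)]
        intro c
        have := hw c
        simp only [northLevels, sPlusL, List.filterMap_cons] at this
        split_ifs at this <;> simpa [sPlusL] using this
      · exact absurd (hw h) key
      · exact absurd (hw h).symm key
      · rw [ih hlen' (h := h - 1)]
        exact hw

/-- Splitting off the longest suffix with a given number of North steps. -/
theorem append_inj_of_count_N {u u' v v' : List Step} (huv : u ++ v = u' ++ v')
    (hc : v.count Step.N = v'.count Step.N) (hu : ∀ s ∈ u.getLast?, s = Step.N)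
    (hu' : ∀ s ∈ u'.getLast?, s = Step.N) : u = u' ∧ v = v' := by
  have aux : ∀ {w : List Step} {a b : List Step}, (∀ s ∈ (w ++ a).getLast?, s = Step.N) →
      (a ++ b).count Step.N = b.count Step.N → a = [] := by
    intro w a b hw hab
    by_contra ha
    have h1 := hw (a.getLast ha) (by simp [List.getLast?_append, List.getLast?_eq_some_getLast ha])
    have h2 : Step.N ∈ a := h1 ▸ List.getLast_mem ha
    have h3 := List.count_pos_iff.2 h2
    rw [List.count_append] at hab
    omega
  rcases List.append_eq_append_iff.1 huv with ⟨a, rfl, rfl⟩ | ⟨a, rfl, rfl⟩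
  · obtain rfl := aux hu' hc
    simp
  · obtain rfl := aux hu hc.symm
    simp

theorem getLast?_append_eq_N {u v : List Step} (hu : ∀ s ∈ u.getLast?, s = Step.N)
    (hv : ∀ s ∈ v.getLast?, s = Step.N) : ∀ s ∈ (u ++ v).getLast?, s = Step.N := by
  grind [List.getLast?_append]

theorem getLast?_descConcat {f : ℕ → List Step} (hf : ∀ j, ∀ s ∈ (f j).getLast?, s = Step.N)
    (m : ℕ) : ∀ s ∈ (descConcat f m).getLast?, s = Step.N := by
  induction m with
  | zero => simp [descConcat_zero]
  | succ m ih => rw [descConcat_succ]; exact getLast?_append_eq_N (hf m) ih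

theorem descConcat_inj {p q p' q' : ℕ → List Step} {m : ℕ}
    (hp0 : (p 0).count Step.N = (p' 0).count Step.N)
    (hq0 : (q 0).count Step.N = (q' 0).count Step.N)
    (hp : ∀ j, (p (j + 1)).count Step.N = (p j).count Step.E)
    (hq : ∀ j, (q (j + 1)).count Step.N = (q j).count Step.E)
    (hp' : ∀ j, (p' (j + 1)).count Step.N = (p' j).count Step.E)
    (hq' : ∀ j, (q' (j + 1)).count Step.N = (q' j).count Step.E)
    (lp : ∀ j, ∀ s ∈ (p j).getLast?, s = Step.N)
    (lq : ∀ j, ∀ s ∈ (q (j + 1)).getLast?, s = Step.N)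
    (lp' : ∀ j, ∀ s ∈ (p' j).getLast?, s = Step.N)
    (lq' : ∀ j, ∀ s ∈ (q' (j + 1)).getLast?, s = Step.N)
    (he : descConcat (fun j => p j ++ q j) m = descConcat (fun j => p' j ++ q' j) m) :
    ∀ j < m, p j = p' j ∧ q j = q' j := by
  induction m generalizing p q p' q' with
  | zero => simp
  | succ m ih =>
    rw [descConcat_succ', descConcat_succ', ← List.append_assoc, ← List.append_assoc] at he
    have l := getLast?_descConcat (fun j => getLast?_append_eq_N (lp (j + 1)) (lq j)) m
    have l' := getLast?_descConcat (fun j => getLast?_append_eq_N (lp' (j + 1)) (lq' j)) m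
    obtain ⟨he, hq00⟩ := append_inj_of_count_N he hq0
      (getLast?_append_eq_N l (lp 0)) (getLast?_append_eq_N l' (lp' 0))
    obtain ⟨he, hp00⟩ := append_inj_of_count_N he hp0 l l'
    have key := ih (by rw [hp, hp', hp00]) (by rw [hq, hq', hq00]) (fun j => hp (j + 1))
      (fun j => hq (j + 1)) (fun j => hp' (j + 1)) (fun j => hq' (j + 1)) (fun j => lp (j + 1))
      (fun j => lq (j + 1)) (fun j => lp' (j + 1)) (fun j => lq' (j + 1)) he
    rintro (_ | j) hj
    · exact ⟨hp00, hq00⟩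
    · exact key j (by omega)

theorem count_descConcat {p q : ℕ → List Step}
    (hp : ∀ j, (p (j + 1)).count Step.N = (p j).count Step.E)
    (hq : ∀ j, (q (j + 1)).count Step.N = (q j).count Step.E) (m : ℕ) :
    (descConcat (fun j => p j ++ q j) (m + 1)).count Step.N + (p m).count Step.E +
        (q m).count Step.E =
      (descConcat (fun j => p j ++ q j) (m + 1)).count Step.E + (p 0).count Step.N +
        (q 0).count Step.N := by
  induction m with
  | zero => simp [descConcat_succ, descConcat_zero]; omega
  | succ m ih =>
    rw [descConcat_succ]
    simp only [List.count_append, hp, hq]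
    omega

/-- Every prefix of the word has at most `h` more East steps than North steps. -/
def BallotFrom (h : ℤ) (w : List Step) : Prop :=
  ∀ k : ℕ, ((w.take k).count Step.E : ℤ) ≤ (w.take k).count Step.N + h

theorem BallotFrom.append {h h' : ℤ} {u v : List Step} (hu : (u.count Step.E : ℤ) ≤ h)
    (hv : BallotFrom h' v) (hh : h' + u.count Step.E ≤ h + u.count Step.N) :
    BallotFrom h (u ++ v) := by
  intro k
  have h1 : (u.take k).count Step.E ≤ u.count Step.E := (List.take_sublist k u).count_le _
  rw [List.take_append, List.count_append, List.count_append]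
  rcases le_total k u.length with hk | hk
  · simp [Nat.sub_eq_zero_of_le hk]
    omega
  · rw [List.take_of_length_le hk]
    have := hv (k - u.length)
    push_cast
    omega

theorem ballotFrom_descConcat {p q : ℕ → List Step}
    (hp : ∀ j, (p (j + 1)).count Step.N = (p j).count Step.E)
    (hq : ∀ j, (q (j + 1)).count Step.N = (q j).count Step.E) (m : ℕ) :
    BallotFrom ((p m).count Step.E + (q m).count Step.E)
      (descConcat (fun j => p j ++ q j) (m + 1)) := by
  induction m with
  | zero =>
    rw [descConcat_succ, List.append_assoc]
    refine BallotFrom.append (by simp)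
      (BallotFrom.append (h := (q 0).count Step.E) (h' := 0) (by simp) ?_ (by simp)) (by grind)
    simp [BallotFrom, descConcat_zero]
  | succ m ih =>
    rw [descConcat_succ, List.append_assoc]
    refine BallotFrom.append (by simp) (BallotFrom.append
      (h := (q (m + 1)).count Step.E + (p (m + 1)).count Step.N) (by simp) ih ?_) (by grind)
    rw [← hp, ← hq]
    grind

/-- An injection from words of excess at least `-h` in every prefix to words whose total excess
lies between `-h` and `h + 1`. -/
def flipUnmatched : ℤ → List Step → List Step
  | _, [] => []
  | h, Step.N :: w =>
      (if ((flipUnmatched (h + 1) w).count Step.N : ℤ) - (flipUnmatched (h + 1) w).count Step.E ≤ h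
        then Step.N else Step.E) :: flipUnmatched (h + 1) w
  | h, Step.E :: w => Step.E :: flipUnmatched (h - 1) w

theorem length_flipUnmatched (h : ℤ) (w : List Step) : (flipUnmatched h w).length = w.length := by
  induction w generalizing h with
  | nil => rfl
  | cons s w ih => cases s <;> simp [flipUnmatched, ih]

theorem BallotFrom.nonneg {h : ℤ} {w : List Step} (hw : BallotFrom h w) : 0 ≤ h := by
  simpa using hw 0

theorem BallotFrom.of_cons_N {h : ℤ} {w : List Step} (hw : BallotFrom h (Step.N :: w)) :
    BallotFrom (h + 1) w := by
  intro k
  have := hw (k + 1)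
  grind

theorem BallotFrom.of_cons_E {h : ℤ} {w : List Step} (hw : BallotFrom h (Step.E :: w)) :
    BallotFrom (h - 1) w := by
  intro k
  have := hw (k + 1)
  grind

theorem excess_flipUnmatched {h : ℤ} {w : List Step} (hw : BallotFrom h w) :
    -h ≤ (flipUnmatched h w).count Step.N - (flipUnmatched h w).count Step.E ∧
      ((flipUnmatched h w).count Step.N : ℤ) - (flipUnmatched h w).count Step.E ≤ h + 1 := by
  induction w generalizing h with
  | nil => have := hw.nonneg; simp [flipUnmatched]; omega
  | cons s w ih =>
    have h0 := hw.nonneg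
    cases s with
    | N => have := ih hw.of_cons_N; simp only [flipUnmatched]; grind
    | E => have := ih hw.of_cons_E; simp only [flipUnmatched]; grind

theorem flipUnmatched_inj {h : ℤ} {w w' : List Step} (hw : BallotFrom h w) (hw' : BallotFrom h w')
    (he : flipUnmatched h w = flipUnmatched h w') : w = w' := by
  induction w generalizing h w' with
  | nil =>
    have := congrArg List.length he
    simp only [length_flipUnmatched, List.length_nil] at this
    exact (List.length_eq_zero_iff.1 this.symm).symm
  | cons s w ih =>
    cases w' with
    | nil => simpa [length_flipUnmatched] using congrArg List.length he
    | cons s' w' =>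
      have key : ∀ {v v' : List Step}, BallotFrom h (Step.E :: v') →
          flipUnmatched h (Step.N :: v) ≠ flipUnmatched h (Step.E :: v') := by
        intro v v' hv' hvv
        have := (excess_flipUnmatched hv'.of_cons_E).2
        simp only [flipUnmatched, List.cons.injEq] at hvv
        rw [← hvv.2] at this
        have h1 := hvv.1
        rw [if_pos (by omega)] at h1
        exact absurd h1 (by decide)
      cases s <;> cases s'
      · rw [ih hw.of_cons_N hw'.of_cons_N (List.cons.inj he).2]
      · exact absurd he (key hw')
      · exact absurd he.symm (key hw)
      · rw [ih hw.of_cons_E hw'.of_cons_E (List.cons.inj he).2]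

theorem count_N_sMinusL_succ (j : ℕ) (a : List ℤ) :
    (sMinusL (j + 1 : ℕ) a).count Step.N = (sMinusL j a).count Step.E := by
  rw [count_N_sMinusL, count_E_sMinusL]
  congr 1
  push_cast
  ring

theorem count_N_reverse_sPlusL_succ (j : ℕ) (a : List ℤ) :
    (sPlusL (j + 1 : ℕ) a).reverse.count Step.N = (sPlusL j a).reverse.count Step.E := by
  rw [List.count_reverse, List.count_reverse, count_N_sPlusL, count_E_sPlusL]
  simp

theorem count_N_add_count_E (w : List Step) : w.count Step.N + w.count Step.E = w.length := by
  induction w with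
  | nil => rfl
  | cons s w ih => cases s <;> grind

theorem IsLatticePath.length_eq {n : ℕ} {π : List Step} (hπ : IsLatticePath n n π) :
    π.length = 2 * n := by
  have := count_N_add_count_E π
  obtain ⟨hE, hN⟩ := hπ
  omega

theorem northLevels_bounds {n : ℕ} {π : List Step} {x : ℤ} (hπ : IsLatticePath n n π)
    (hx : x ∈ northLevels π 0) : -(n : ℤ) < x ∧ x ≤ n := by
  have := mem_northLevels_bounds hx
  obtain ⟨hE, hN⟩ := hπ
  omega

theorem count_E_sMinusL_northLevels {n : ℕ} {π : List Step} (hπ : IsLatticePath n n π) :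
    (sMinusL n (northLevels π 0)).count Step.E = 0 := by
  rw [count_E_sMinusL, List.count_eq_zero]
  intro hx
  have := northLevels_bounds hπ hx
  omega

theorem count_E_reverse_sPlusL_northLevels {n : ℕ} {π : List Step} (hπ : IsLatticePath n n π) :
    (sPlusL n (northLevels π 0)).reverse.count Step.E = 0 := by
  rw [List.count_reverse, count_E_sPlusL, List.count_eq_zero]
  intro hx
  have := northLevels_bounds hπ hx
  omega

theorem count_N_zetaC {n : ℕ} {π : List Step} (hπ : IsLatticePath n n π) :
    (zetaC n π).count Step.N = (zetaC n π).count Step.E + 2 * (northLevels π 0).count 0 := by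
  have := count_descConcat (p := fun j => sMinusL j (northLevels π 0))
    (q := fun j => (sPlusL j (northLevels π 0)).reverse)
    (fun j => count_N_sMinusL_succ j _) (fun j => count_N_reverse_sPlusL_succ j _) n
  simp only [← zetaC_eq_descConcat hπ.2, count_E_sMinusL_northLevels hπ,
    count_E_reverse_sPlusL_northLevels hπ, List.count_reverse, count_N_sPlusL, count_N_sMinusL,
    Nat.cast_zero, neg_zero] at this
  omega

theorem ballotFrom_zetaC {n : ℕ} {π : List Step} (hπ : IsLatticePath n n π) :
    BallotFrom 0 (zetaC n π) := by
  have := ballotFrom_descConcat (p := fun j => sMinusL j (northLevels π 0))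
    (q := fun j => (sPlusL j (northLevels π 0)).reverse)
    (fun j => count_N_sMinusL_succ j _) (fun j => count_N_reverse_sPlusL_succ j _) n
  simpa only [← zetaC_eq_descConcat hπ.2, count_E_sMinusL_northLevels hπ,
    count_E_reverse_sPlusL_northLevels hπ, Nat.cast_zero, add_zero] using this

theorem zetaC_injOn (n : ℕ) : Set.InjOn (zetaC n) {π | IsLatticePath n n π} := by
  intro π hπ π' hπ' he
  have hc := count_N_zetaC hπ
  have hc' := count_N_zetaC hπ'
  rw [he] at hc
  rw [zetaC_eq_descConcat hπ.2, zetaC_eq_descConcat hπ'.2] at he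
  have hlast : ∀ {π : List Step}, IsLatticePath n n π → ∀ j : ℕ,
      ∀ s ∈ (sMinusL j (northLevels π 0)).getLast?, s = Step.N := fun hπ j =>
    (getLast?_sMinusL_northLevels (by rw [hπ.1, hπ.2, zero_add]) (by omega)).1
  have hlast' : ∀ (π : List Step) (j : ℕ),
      ∀ s ∈ (sPlusL (j + 1 : ℕ) (northLevels π 0)).reverse.getLast?, s = Step.N := fun π j => by
    rw [List.getLast?_reverse]
    exact head?_sPlusL_northLevels (by omega)
  have key := descConcat_inj (p := fun j => sMinusL j (northLevels π 0))
    (q := fun j => (sPlusL j (northLevels π 0)).reverse)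
    (p' := fun j => sMinusL j (northLevels π' 0))
    (q' := fun j => (sPlusL j (northLevels π' 0)).reverse)
    (by simp only [count_N_sMinusL]; simp; omega)
    (by simp only [List.count_reverse, count_N_sPlusL]; simp; omega)
    (fun j => count_N_sMinusL_succ j _) (fun j => count_N_reverse_sPlusL_succ j _)
    (fun j => count_N_sMinusL_succ j _) (fun j => count_N_reverse_sPlusL_succ j _)
    (hlast hπ) (hlast' π) (hlast hπ') (hlast' π') he
  refine eq_of_sPlusL_northLevels_eq (h := 0) (by rw [hπ.length_eq, hπ'.length_eq]) fun c => ?_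
  have hnil : ∀ {π : List Step}, IsLatticePath n n π → (c < -(n : ℤ) - 1 ∨ (n : ℤ) < c) →
      sPlusL c (northLevels π 0) = [] := by
    intro π hπ hc
    refine List.filterMap_eq_nil_iff.2 fun x hx => ?_
    have := northLevels_bounds hπ hx
    rw [if_neg (by omega), if_neg (by omega)]
  by_cases hc : c < -(n : ℤ) - 1 ∨ (n : ℤ) < c
  · rw [hnil hπ hc, hnil hπ' hc]
  rcases le_or_gt 0 c with h0 | h0
  · obtain ⟨j, rfl⟩ := Int.eq_ofNat_of_zero_le h0
    simpa using (key j (by omega)).2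
  · obtain ⟨j, hj⟩ := Int.eq_ofNat_of_zero_le (show 0 ≤ -c - 1 by omega)
    obtain rfl : c = -(j : ℤ) - 1 := by omega
    rw [sPlusL_eq_map_swap, sPlusL_eq_map_swap, (key j (by omega)).1]

/-- The steps of a path starting at level `c`, labelled by `2 n c + b` where `b` is the number of
North steps so far; `h` and `b` are the level and the number of North steps at the start. -/
def stepsFrom (n : ℕ) (c : ℤ) : List Step → ℤ → ℤ → List (Step × ℤ)
  | [], _, _ => []
  | Step.N :: r, h, b =>
      (if h = c then [(Step.N, 2 * n * h + b)] else []) ++ stepsFrom n c r (h + 1) (b + 1)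
  | Step.E :: r, h, b =>
      (if h = c then [(Step.E, 2 * n * h + b)] else []) ++ stepsFrom n c r (h - 1) b

/-- The steps of a path ending at level `c`, labelled by `-(2 n c + b)` where `b` is the number of
North steps up to and including the step. -/
def stepsTo (n : ℕ) (c : ℤ) : List Step → ℤ → ℤ → List (Step × ℤ)
  | [], _, _ => []
  | Step.N :: r, h, b =>
      (if h + 1 = c then [(Step.N, -(2 * n * (h + 1) + (b + 1)))] else []) ++
        stepsTo n c r (h + 1) (b + 1)
  | Step.E :: r, h, b =>
      (if h - 1 = c then [(Step.E, -(2 * n * (h - 1) + b))] else []) ++ stepsTo n c r (h - 1) b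

/-- All the labelled steps of a path which start at a negative level or end at a nonnegative one. -/
def labelledSteps (n : ℕ) : List Step → ℤ → ℤ → Multiset (Step × ℤ)
  | [], _, _ => 0
  | Step.N :: r, h, b =>
      (if h < 0 then {(Step.N, 2 * n * h + b)} else 0) +
        (if 0 ≤ h + 1 then {(Step.N, -(2 * n * (h + 1) + (b + 1)))} else 0) +
        labelledSteps n r (h + 1) (b + 1)
  | Step.E :: r, h, b =>
      (if h < 0 then {(Step.E, 2 * n * h + b)} else 0) +
        (if 0 ≤ h - 1 then {(Step.E, -(2 * n * (h - 1) + b))} else 0) +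
        labelledSteps n r (h - 1) b

section Words

variable {n : ℕ} {π : List Step} {h b j : ℤ}

theorem sMinusL_northLevels (hend : h + π.count Step.N = π.count Step.E) (hj : 0 ≤ j) :
    sMinusL j (northLevels π h) =
      (if h < -j - 1 then [Step.E] else []) ++
        (stepsFrom n (-j - 1) π h b).map Prod.fst := by
  induction π generalizing h b with
  | nil => simp at hend; simp [northLevels, sMinusL, stepsFrom]; omega
  | cons s r ih =>
    cases s with
    | N =>
      have := ih (h := h + 1) (b := b + 1) (by grind)
      simp only [northLevels, stepsFrom, sMinusL_cons, this]
      grind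
    | E =>
      have := ih (h := h - 1) (b := b) (by grind)
      simp only [northLevels, stepsFrom, this]
      grind

theorem sPlusL_northLevels (hend : h + π.count Step.N = π.count Step.E) (hj : 0 ≤ j) :
    (if j < h then [Step.E] else []) ++ sPlusL j (northLevels π h) =
      (stepsTo n j π h b).map Prod.fst := by
  induction π generalizing h b with
  | nil => simp at hend; simp [northLevels, sPlusL, stepsTo]; omega
  | cons s r ih =>
    cases s with
    | N =>
      have := ih (h := h + 1) (b := b + 1) (by grind)
      simp only [northLevels, stepsTo, sPlusL_cons, List.map_append, ← this]
      grind
    | E =>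
      have := ih (h := h - 1) (b := b) (by grind)
      simp only [northLevels, stepsTo, List.map_append, ← this]
      grind

end Words

section Sorted

variable {n : ℕ} {c : ℤ} {π : List Step} {h b : ℤ}

theorem label_stepsFrom (hend : h + π.count Step.N = π.count Step.E) (hc : c < 0) :
    ∀ p ∈ stepsFrom n c π h b, 2 * n * c + b ≤ p.2 ∧ (h < c → 2 * n * c + b < p.2) ∧
      p.2 < 2 * n * c + b + π.count Step.N := by
  induction π generalizing h b with
  | nil => simp [stepsFrom]
  | cons s r ih =>
    intro p hp
    cases s with
    | N =>
      have := @ih (h + 1) (b + 1) (by grind) p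
      simp only [stepsFrom, List.mem_append] at hp
      grind
    | E =>
      have := @ih (h - 1) b (by grind) p
      simp only [stepsFrom, List.mem_append] at hp
      grind

theorem pairwise_stepsFrom (hend : h + π.count Step.N = π.count Step.E) (hc : c < 0) :
    (stepsFrom n c π h b).Pairwise fun p q => p.2 < q.2 := by
  induction π generalizing h b with
  | nil => simp [stepsFrom]
  | cons s r ih =>
    cases s with
    | N =>
      have e : (h + 1) + r.count Step.N = r.count Step.E := by grind
      rw [stepsFrom, List.pairwise_append]
      refine ⟨by split_ifs <;> simp, ih e, fun p hp q hq => ?_⟩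
      have := label_stepsFrom e hc q hq
      grind
    | E =>
      have e : (h - 1) + r.count Step.N = r.count Step.E := by grind
      rw [stepsFrom, List.pairwise_append]
      refine ⟨by split_ifs <;> simp, ih e, fun p hp q hq => ?_⟩
      have := label_stepsFrom e hc q hq
      grind

theorem label_stepsTo :
    ∀ p ∈ stepsTo n c π h b, 2 * n * c + b ≤ -p.2 ∧ (h ≤ c → 2 * n * c + b < -p.2) ∧
      -p.2 ≤ 2 * n * c + b + π.count Step.N := by
  induction π generalizing h b with
  | nil => simp [stepsTo]
  | cons s r ih =>
    intro p hp
    cases s with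
    | N =>
      have := @ih (h + 1) (b + 1) p
      simp only [stepsTo, List.mem_append] at hp
      grind
    | E =>
      have := @ih (h - 1) b p
      simp only [stepsTo, List.mem_append] at hp
      grind

theorem pairwise_stepsTo : (stepsTo n c π h b).Pairwise fun p q => q.2 < p.2 := by
  induction π generalizing h b with
  | nil => simp [stepsTo]
  | cons s r ih =>
    cases s with
    | N =>
      rw [stepsTo, List.pairwise_append]
      refine ⟨by split_ifs <;> simp, ih, fun p hp q hq => ?_⟩
      have := label_stepsTo q hq
      grind
    | E =>
      rw [stepsTo, List.pairwise_append]
      refine ⟨by split_ifs <;> simp, ih, fun p hp q hq => ?_⟩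
      have := label_stepsTo q hq
      grind

end Sorted

/-- The labelled steps belonging to the `j`-th block of the zeta map. -/
def labelledBlock (n : ℕ) (π : List Step) (j : ℕ) : List (Step × ℤ) :=
  stepsFrom n (-j - 1) π 0 0 ++ (stepsTo n j π 0 0).reverse

theorem zetaC_eq_map_fst {n : ℕ} {π : List Step} (hπ : IsLatticePath n n π) :
    zetaC n π = (descConcat (labelledBlock n π) (n + 1)).map Prod.fst := by
  obtain ⟨hE, hN⟩ := hπ
  rw [zetaC_eq_descConcat hN]
  simp only [descConcat, List.map_flatten, List.map_map]
  congr 1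
  refine List.map_congr_left fun j _ => ?_
  have h1 := sMinusL_northLevels (n := n) (π := π) (h := 0) (b := 0) (j := j) (by omega) (by omega)
  have h2 := sPlusL_northLevels (n := n) (π := π) (h := 0) (b := 0) (j := j) (by omega) (by omega)
  rw [if_neg (by omega), List.nil_append] at h1 h2
  simp [labelledBlock, h1, h2]

theorem pairwise_descConcat_labelledBlock {n : ℕ} {π : List Step} (hπ : IsLatticePath n n π)
    (m : ℕ) :
    (descConcat (labelledBlock n π) m).Pairwise (fun p q => p.2 < q.2) ∧
      ∀ p ∈ descConcat (labelledBlock n π) m, -(2 * n * m : ℤ) ≤ p.2 := by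
  obtain ⟨hE, hN⟩ := hπ
  induction m with
  | zero => simp [descConcat_zero]
  | succ m ih =>
    have hfrom := label_stepsFrom (n := n) (c := -m - 1) (π := π) (h := 0) (b := 0)
      (by omega) (by omega)
    have hto := label_stepsTo (n := n) (c := m) (π := π) (h := 0) (b := 0)
    rw [hN] at hfrom hto
    have e : (2 * n * (-m - 1) : ℤ) = -(2 * n * m) - 2 * n := by ring
    have e' : (2 * n * (m + 1 : ℕ) : ℤ) = 2 * n * m + 2 * n := by push_cast; ring
    rw [e] at hfrom
    rw [e', descConcat_succ, labelledBlock]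
    generalize (2 * n * m : ℤ) = t at *
    constructor
    · rw [List.pairwise_append, List.pairwise_append, List.pairwise_reverse]
      refine ⟨⟨pairwise_stepsFrom (by omega) (by omega), pairwise_stepsTo, ?_⟩, ih.1, ?_⟩
      · intro p hp q hq
        have := hfrom p hp
        have := hto q (List.mem_reverse.1 hq)
        omega
      · intro p hp q hq
        have hq := ih.2 q hq
        rcases List.mem_append.1 hp with hp | hp
        · have := hfrom p hp
          omega
        · have := hto p (List.mem_reverse.1 hp)
          omega
    · intro p hp
      simp only [List.mem_append, List.mem_reverse] at hp
      rcases hp with (hp | hp) | hp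
      · have := hfrom p hp
        omega
      · have := hto p hp
        omega
      · have := ih.2 p hp
        omega

theorem sum_steps_eq_labelledSteps {n : ℕ} {π : List Step} {h b : ℤ}
    (hN : h + π.count Step.N ≤ n) (hE : -n ≤ h - π.count Step.E) :
    ∑ j ∈ Finset.range (n + 1), ((stepsFrom n (-j - 1) π h b : Multiset (Step × ℤ)) +
      (stepsTo n j π h b : Multiset (Step × ℤ))) = labelledSteps n π h b := by
  have hfrom : ∀ (h : ℤ) (x : Step × ℤ), -n ≤ h →
      ∑ j ∈ Finset.range (n + 1), ((if h = -(j : ℤ) - 1 then [x] else [] : List (Step × ℤ)) :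
        Multiset (Step × ℤ)) = if h < 0 then {x} else 0 := by
    intro h x hh
    split_ifs with h0
    · rw [Finset.sum_eq_single_of_mem (-h - 1).toNat (by simp; omega)]
      · rw [if_pos (by omega)]; rfl
      · intro j _ hj
        rw [if_neg (by omega)]; rfl
    · refine Finset.sum_eq_zero fun j _ => ?_
      rw [if_neg (by omega)]; rfl
  have hto : ∀ (h : ℤ) (x : Step × ℤ), h ≤ n →
      ∑ j ∈ Finset.range (n + 1), ((if h = (j : ℤ) then [x] else [] : List (Step × ℤ)) :
        Multiset (Step × ℤ)) = if 0 ≤ h then {x} else 0 := by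
    intro h x hh
    split_ifs with h0
    · rw [Finset.sum_eq_single_of_mem h.toNat (by simp; omega)]
      · rw [if_pos (by omega)]; rfl
      · intro j _ hj
        rw [if_neg (by omega)]; rfl
    · refine Finset.sum_eq_zero fun j _ => ?_
      rw [if_neg (by omega)]; rfl
  induction π generalizing h b with
  | nil => simp [stepsFrom, stepsTo, labelledSteps]
  | cons s r ih =>
    cases s with
    | N =>
      rw [labelledSteps, ← ih (by grind) (by grind), ← hfrom h _ (by grind),
        ← hto (h + 1) _ (by grind)]
      simp only [stepsFrom, stepsTo, ← Multiset.coe_add, ← Finset.sum_add_distrib]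
      refine Finset.sum_congr rfl fun j _ => ?_
      abel
    | E =>
      rw [labelledSteps, ← ih (by grind) (by grind), ← hfrom h _ (by grind),
        ← hto (h - 1) _ (by grind)]
      simp only [stepsFrom, stepsTo, ← Multiset.coe_add, ← Finset.sum_add_distrib]
      refine Finset.sum_congr rfl fun j _ => ?_
      abel

theorem coe_descConcat {α : Type*} (f : ℕ → List α) (m : ℕ) :
    (descConcat f m : Multiset α) = ∑ j ∈ Finset.range m, (f j : Multiset α) := by
  induction m with
  | zero => rfl
  | succ m ih => rw [descConcat_succ, Finset.sum_range_succ, ← ih, add_comm, Multiset.coe_add]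

/-- The recursive form of `sweepX`: `l` is the label of the first step of the word, `p` is the step
preceding it and `z` is the step attached to the label `0`. -/
def sweepAux (n : ℕ) (z : Step) : List Step → Step → ℤ → List (Step × ℤ)
  | [], _, _ => []
  | s :: r, p, l =>
      (if l < 0 then (s, l) else if 0 < l then (p, -l) else (z, -(n : ℤ))) ::
        sweepAux n z r s (if s = Step.N then l + (2 * (n : ℤ) + 1) else l - 2 * (n : ℤ))

theorem length_sweepAux (n : ℕ) (z : Step) (r : List Step) (p : Step) (l : ℤ) :
    (sweepAux n z r p l).length = r.length := by
  induction r generalizing p l with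
  | nil => rfl
  | cons s r ih => simp [sweepAux, ih]

theorem filterMap_eq_sweepAux (n : ℕ) (z : Step) (r : List Step) (p : Step) (l : ℤ) :
    ((List.range r.length).filterMap fun i =>
      match (sweepLabels n r l)[i]? with
      | some l =>
        if l < 0 then (r[i]?).map (fun s => (s, l))
        else if 0 < l then ((p :: r)[i]?).map (fun s => (s, -l))
        else some (z, -(n : ℤ))
      | none => none) = sweepAux n z r p l := by
  induction r generalizing p l with
  | nil => rfl
  | cons s r ih =>
    rw [List.length_cons, List.range_succ_eq_map, List.filterMap_cons, List.filterMap_map]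
    rw [sweepAux, ← ih]
    simp only [sweepLabels, List.getElem?_cons_zero, Option.map_some]
    split_ifs <;> rfl

theorem sweepX_cons (n : ℕ) (s z : Step) (r : List Step) (hz : (s :: r).getLast? = some z) :
    sweepX n (s :: r) = (z, -(n : ℤ)) ::
      sweepAux n z r s (if s = Step.N then 2 * (n : ℤ) + 1 else -(2 * (n : ℤ))) := by
  rw [← filterMap_eq_sweepAux, sweepX, hz, List.length_cons, List.range_succ_eq_map,
    List.filterMap_cons, List.filterMap_map]
  simp only [sweepLabels, List.getElem?_cons_zero, lt_irrefl, if_false, Option.map_some, zero_add,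
    zero_sub]
  rfl

theorem length_sweep (n : ℕ) (π : List Step) : (sweep n π).length = π.length := by
  rw [sweep, List.length_map, List.length_insertionSort]
  cases π with
  | nil => rfl
  | cons s r =>
    rw [sweepX_cons n s _ r (List.getLast?_eq_some_getLast (List.cons_ne_nil s r))]
    simp [length_sweepAux]

theorem coe_sweepAux {n : ℕ} {z p : Step} {r : List Step} {h b l : ℤ}
    (hend : h + r.count Step.N = r.count Step.E) (hb : b + r.count Step.N = n) (hb0 : 0 ≤ b)
    (hhb : 0 ≤ h → 0 < b) (hn : 0 < n) (hl : l = 2 * n * h + b) :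
    (sweepAux n z r p l : Multiset (Step × ℤ)) + {((p :: r).getLast (by simp), -(n : ℤ))} =
      (if 0 ≤ h then {(p, -l)} else 0) + labelledSteps n r h b := by
  induction r generalizing p h b l with
  | nil =>
    simp only [List.count_nil, Nat.cast_zero, add_zero] at hend hb
    subst hend hb hl
    simp [sweepAux, labelledSteps]
  | cons s r ih =>
    have hhead : ∀ M : Multiset (Step × ℤ),
        ({if l < 0 then (s, l) else if 0 < l then (p, -l) else (z, -(n : ℤ))} : Multiset _) + M =
        (if 0 ≤ h then {(p, -l)} else 0) + ((if h < 0 then {(s, l)} else 0) + M) := by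
      intro M
      rcases lt_or_ge h 0 with h0 | h0
      · have : l < 0 := by nlinarith
        simp [this, h0, h0.not_ge]
      · have : 0 < l := by have := hhb h0; rw [hl]; positivity
        simp [this, this.not_gt, h0, h0.not_gt]
    rw [sweepAux, ← Multiset.cons_coe, ← Multiset.singleton_add, add_assoc,
      List.getLast_cons (by simp)]
    cases s with
    | N =>
      rw [ih (h := h + 1) (b := b + 1) (by grind) (by grind) (by omega) (by omega)
        (by rw [hl, if_pos rfl]; ring), hhead, labelledSteps, if_pos rfl]
      rw [show l + (2 * n + 1) = 2 * n * (h + 1) + (b + 1) by rw [hl]; ring, hl]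
      simp only [add_assoc]
    | E =>
      rw [ih (h := h - 1) (b := b) (by grind) (by grind) (by omega) (by omega)
        (by rw [hl, if_neg Step.noConfusion]; ring), hhead, labelledSteps, if_neg (c := Step.E = Step.N) Step.noConfusion]
      rw [show l - 2 * n = 2 * n * (h - 1) + b by rw [hl]; ring, hl]
      simp only [add_assoc]

theorem coe_sweepX {n : ℕ} {π : List Step} (hπ : IsLatticePath n n π) :
    (sweepX n π : Multiset (Step × ℤ)) = labelledSteps n π 0 0 := by
  obtain ⟨hE, hN⟩ := hπ
  cases π with
  | nil => rfl
  | cons s r =>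
    rw [sweepX_cons n s _ r (List.getLast?_eq_some_getLast (List.cons_ne_nil s r)),
      ← Multiset.cons_coe, ← Multiset.singleton_add, add_comm]
    cases s with
    | N =>
      rw [coe_sweepAux (h := 1) (b := 1) (by grind) (by grind) (by omega) (by omega) (by grind)
        (by simp), labelledSteps]
      simp
    | E =>
      rw [coe_sweepAux (h := -1) (b := 0) (by grind) (by grind) (by omega) (by omega) (by grind)
        (by simp), labelledSteps]
      simp

theorem sweep_eq_zetaC_of_isLatticePath {n : ℕ} {π : List Step} (hπ : IsLatticePath n n π) :
    sweep n π = zetaC n π := by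
  rw [zetaC_eq_map_fst hπ, sweep]
  congr 1
  have hperm : (sweepX n π).Perm (descConcat (labelledBlock n π) (n + 1)) := by
    rw [← Multiset.coe_eq_coe, coe_sweepX hπ, coe_descConcat,
      ← sum_steps_eq_labelledSteps (by simp [hπ.2]) (by simp [hπ.1])]
    simp [labelledBlock, ← Multiset.coe_add]
  have hsort := (pairwise_descConcat_labelledBlock hπ (n + 1)).1
  have htot : Std.Total fun p q : Step × ℤ => p.2 ≤ q.2 := ⟨fun p q => le_total p.2 q.2⟩
  have htrans : IsTrans (Step × ℤ) fun p q => p.2 ≤ q.2 := ⟨fun _ _ _ => le_trans⟩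
  refine ((List.perm_insertionSort _ _).trans hperm).eq_of_pairwise ?_
    (List.pairwise_insertionSort _ _) (hsort.imp le_of_lt)
  intro p q hp hq hpq hqp
  have hp' := ((List.perm_insertionSort _ _).trans hperm).mem_iff.1 hp
  have hsymm : Std.Symm fun p q : Step × ℤ => p.2 = q.2 → p = q :=
    ⟨fun _ _ h e => (h e.symm).symm⟩
  have hpair : (descConcat (labelledBlock n π) (n + 1)).Pairwise fun p q => p.2 = q.2 → p = q :=
    hsort.imp fun h e => absurd e h.ne
  exact hpair.forall_of_forall (fun _ _ _ => rfl) hp' hq (le_antisymm hpq hqp)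

instance : Finite Step :=
  Finite.of_injective (fun s => decide (s = Step.N)) fun s t => by cases s <;> cases t <;> simp

theorem finite_setOf_length_eq (m : ℕ) (P : List Step → Prop)
    (hP : ∀ w, P w → w.length = m) : {w | P w}.Finite :=
  (List.finite_length_eq Step m).subset hP

theorem isBallotPath_iff {m : ℕ} {w : List Step} :
    IsBallotPath m w ↔ w.length = m ∧ BallotFrom 0 w := by
  simp [IsBallotPath, BallotFrom]

theorem isLatticePath_flipUnmatched {n : ℕ} {w : List Step} (hw : IsBallotPath (2 * n) w) :
    IsLatticePath n n (flipUnmatched 0 w) := by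
  obtain ⟨hlen, hw⟩ := isBallotPath_iff.1 hw
  have h1 := excess_flipUnmatched hw
  have h2 := count_N_add_count_E (flipUnmatched 0 w)
  rw [length_flipUnmatched, hlen] at h2
  constructor <;> omega

theorem isBallotPath_sweep {n : ℕ} {π : List Step} (hπ : IsLatticePath n n π) :
    IsBallotPath (2 * n) (sweep n π) := by
  refine isBallotPath_iff.2 ⟨by rw [length_sweep, hπ.length_eq], ?_⟩
  rw [sweep_eq_zetaC_of_isLatticePath hπ]
  exact ballotFrom_zetaC hπ

/-- For every lattice path `π ∈ L_{n,n}` one has `sw(π) = ζ_C(π)`;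
in particular the sweep map is a bijection from `L_{n,n}` onto `B_{2n}`. -/
theorem sweep_eq_zetaC (n : ℕ) :
    (∀ π : List Step, IsLatticePath n n π → sweep n π = zetaC n π) ∧
    Set.BijOn (sweep n) {π : List Step | IsLatticePath n n π}
      {β : List Step | IsBallotPath (2 * n) β} := by
  have hinj : Set.InjOn (sweep n) {π : List Step | IsLatticePath n n π} :=
    (zetaC_injOn n).congr fun π hπ => (sweep_eq_zetaC_of_isLatticePath hπ).symm
  have hmaps : Set.MapsTo (sweep n) {π | IsLatticePath n n π} {β | IsBallotPath (2 * n) β} :=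
    fun π => isBallotPath_sweep
  refine ⟨fun π => sweep_eq_zetaC_of_isLatticePath, hmaps, hinj, ?_⟩
  refine (Set.eq_of_subset_of_ncard_le hmaps.image_subset ?_
    (finite_setOf_length_eq _ _ fun w hw => hw.1)).ge
  rw [hinj.ncard_image]
  exact Set.ncard_le_ncard_of_injOn (flipUnmatched 0) (fun w => isLatticePath_flipUnmatched)
    (fun w hw w' hw' => flipUnmatched_inj (isBallotPath_iff.1 hw).2 (isBallotPath_iff.1 hw').2)
    (finite_setOf_length_eq _ _ fun w hw => hw.length_eq)
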